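/- Let m ≥ 1, N > 2m, n ≥ 2, and let e_{ij} = 1 if i ≠ j and e_{ij} = 0 if i = j. Let p_{ij} ≥ 1, q_{ij} > 0 with p_{ij} + q_{ij} ≥ 2 for all i ≠ j, let each Ψ_{ij} satisfy condition (K), and assume that for every pair k ≠ ℓ one has limsup_{r→∞} min{ r^{2N−(N−2m)(p_{kℓ}+q_{kℓ})} Ψ_{kℓ}(r), r^{2N−(N−2m)(p_{ℓk}+q_{ℓk})} Ψ_{ℓk}(r) } > 0. Then the only non-negative solution of the system (−Δ)^m u_i ≥ Σ_{j=1}^n e_{ij} (Ψ_{ij}(|·|) * u_j^{p_{ij}}) u_j^{q_{ij}} in ℝ^N, 1 ≤ i ≤ n, is (u_1, …, u_n) = (0, …, 0). -/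

import Mathlib

open MeasureTheory Filter Metric

/-- The Laplacian of `u : ℝ^N → ℝ`, defined via the second iterated Fréchet derivative. -/
noncomputable def lap {N : ℕ} (u : EuclideanSpace ℝ (Fin N) → ℝ) :
    EuclideanSpace ℝ (Fin N) → ℝ :=
  fun x => ∑ i : Fin N,
    iteratedFDeriv ℝ 2 u x ![EuclideanSpace.single i 1, EuclideanSpace.single i 1]

/-- `negLapPow m u = (-Δ)^m u`, the `m`-fold iterate of the negative Laplacian. -/
noncomputable def negLapPow {N : ℕ} (m : ℕ) (u : EuclideanSpace ℝ (Fin N) → ℝ) :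
    EuclideanSpace ℝ (Fin N) → ℝ :=
  (fun v => fun x => -(lap v x))^[m] u

/-- Condition (K) on the kernel `Ψ`. -/
structure CondK (N : ℕ) (Ψ : ℝ → ℝ) : Prop where
  pos : ∀ r : ℝ, 0 < r → 0 < Ψ r
  cont : ContinuousOn (fun x : EuclideanSpace ℝ (Fin N) => Ψ ‖x‖)
    {(0 : EuclideanSpace ℝ (Fin N))}ᶜ
  locInt : LocallyIntegrable (fun x : EuclideanSpace ℝ (Fin N) => Ψ ‖x‖) volume
  anti : AntitoneOn Ψ (Set.Ioi (0 : ℝ))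
  tendsto : Tendsto (fun r : ℝ => r ^ N * Ψ r) atTop atTop


open scoped ContDiff Topology Pointwise

section Laplacian

lemma two_le_infty : (2 : WithTop ℕ∞) ≤ ∞ := by
  exact WithTop.coe_le_coe.2 (le_top : (2 : ℕ∞) ≤ ⊤)

variable {N : ℕ}

lemma lap_eq_laplacian (f : EuclideanSpace ℝ (Fin N) → ℝ) :
    lap f = Laplacian.laplacian f := by
  rw [InnerProductSpace.laplacian_eq_iteratedFDeriv_orthonormalBasis f
    (EuclideanSpace.basisFun (Fin N) ℝ)]
  simp only [EuclideanSpace.basisFun_apply]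
  rfl

lemma lap_sub {f g : EuclideanSpace ℝ (Fin N) → ℝ} (hf : ContDiff ℝ 2 f) (hg : ContDiff ℝ 2 g) :
    lap (fun x => f x - g x) = fun x => lap f x - lap g x := by
  ext x
  simp only [lap_eq_laplacian]
  exact hf.contDiffAt.laplacian_sub hg.contDiffAt

lemma lap_const_mul (c : ℝ) {f : EuclideanSpace ℝ (Fin N) → ℝ}
    {x : EuclideanSpace ℝ (Fin N)} (hf : ContDiffAt ℝ 2 f x) :
    lap (fun x => c * f x) x = c * lap f x := by
  simp only [lap_eq_laplacian]
  exact InnerProductSpace.laplacian_smul c hf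

lemma lap_congr_nhds {f g : EuclideanSpace ℝ (Fin N) → ℝ} {x : EuclideanSpace ℝ (Fin N)}
    (h : f =ᶠ[𝓝 x] g) : lap f =ᶠ[𝓝 x] lap g := by
  rw [lap_eq_laplacian, lap_eq_laplacian]
  exact InnerProductSpace.laplacian_congr_nhds h

lemma lap_comp_smul (c : ℝ) (f : EuclideanSpace ℝ (Fin N) → ℝ) :
    lap (fun x => f (c • x)) = fun x => c ^ 2 * lap f (c • x) := by
  ext x
  have h1 : fderiv ℝ (fun x => f (c • x)) = fun x => c • fderiv ℝ f (c • x) := by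
    ext1 y
    exact fderiv_comp_smul (f := f) c
  have h2 : fderiv ℝ (fun x => c • fderiv ℝ f (c • x)) x
      = c • c • fderiv ℝ (fderiv ℝ f) (c • x) := by
    rw [show (fun x => c • fderiv ℝ f (c • x)) = c • (fun x => fderiv ℝ f (c • x)) from rfl,
      congrFun (fderiv_const_smul_field (𝕜 := ℝ) (f := fun x => fderiv ℝ f (c • x)) c) x,
      Pi.smul_apply, fderiv_comp_smul (f := fderiv ℝ f) c]
  simp only [lap, iteratedFDeriv_two_apply, h1, h2, Finset.mul_sum]
  refine Finset.sum_congr rfl fun i _ => ?_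
  simp
  ring

lemma lap_eq_sum_fderiv {f : EuclideanSpace ℝ (Fin N) → ℝ} {x : EuclideanSpace ℝ (Fin N)}
    (hf : ContDiffAt ℝ 2 f x) :
    lap f x = ∑ i : Fin N, fderiv ℝ (fun y => fderiv ℝ f y (EuclideanSpace.single i 1)) x
      (EuclideanSpace.single i 1) := by
  have hd : DifferentiableAt ℝ (fderiv ℝ f) x :=
    (hf.fderiv_right (m := 1) (by norm_num)).differentiableAt (by norm_num)
  simp only [lap, iteratedFDeriv_two_apply]
  refine Finset.sum_congr rfl fun i _ => ?_
  rw [fderiv_clm_apply hd (differentiableAt_const _)]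
  simp

lemma contDiff_lap {f : EuclideanSpace ℝ (Fin N) → ℝ} {k n : WithTop ℕ∞} (hf : ContDiff ℝ n f)
    (hk : k + 2 ≤ n) : ContDiff ℝ k (lap f) := by
  unfold lap
  refine ContDiff.sum fun i _ => ?_
  have h := hf.iteratedFDeriv_right (i := 2) (m := k) (by exact_mod_cast hk)
  exact (ContinuousMultilinearMap.apply ℝ (fun _ : Fin 2 => EuclideanSpace ℝ (Fin N)) ℝ
    ![EuclideanSpace.single i 1, EuclideanSpace.single i 1]).contDiff.comp h

lemma integral_mul_lap {φ u : EuclideanSpace ℝ (Fin N) → ℝ} (hφ : ContDiff ℝ 2 φ)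
    (hc : HasCompactSupport φ) (hu : ContDiff ℝ 2 u) :
    ∫ x, φ x * lap u x = ∫ x, lap φ x * u x := by
  have hD : ∀ (f : EuclideanSpace ℝ (Fin N) → ℝ), ContDiff ℝ 2 f → ∀ i : Fin N,
      ContDiff ℝ 1 (fun y => fderiv ℝ f y (EuclideanSpace.single i 1)) := fun f hf i =>
    (hf.fderiv_right (m := 1) (by norm_num)).clm_apply contDiff_const
  have hDD : ∀ (f : EuclideanSpace ℝ (Fin N) → ℝ), ContDiff ℝ 2 f → ∀ i : Fin N,
      Continuous (fun x => fderiv ℝ (fun y => fderiv ℝ f y (EuclideanSpace.single i 1)) x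
        (EuclideanSpace.single i 1)) := fun f hf i =>
    ((hD f hf i).continuous_fderiv (by norm_num)).clm_apply continuous_const
  have hcD : ∀ i : Fin N, HasCompactSupport
      (fun y => fderiv ℝ φ y (EuclideanSpace.single i 1)) := fun i =>
    hc.fderiv_apply ℝ _
  have hcDD : ∀ i : Fin N, HasCompactSupport
      (fun x => fderiv ℝ (fun y => fderiv ℝ φ y (EuclideanSpace.single i 1)) x
        (EuclideanSpace.single i 1)) := fun i =>
    (hcD i).fderiv_apply ℝ _
  have key : ∀ i : Fin N,
      ∫ x, φ x * fderiv ℝ (fun y => fderiv ℝ u y (EuclideanSpace.single i 1)) x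
        (EuclideanSpace.single i 1)
      = ∫ x, fderiv ℝ (fun y => fderiv ℝ φ y (EuclideanSpace.single i 1)) x
        (EuclideanSpace.single i 1) * u x := by
    intro i
    have i1 := (hD φ hφ i).continuous.mul (hD u hu i).continuous |>.integrable_of_hasCompactSupport
      (μ := volume) ((hcD i).mul_right)
    rw [integral_mul_fderiv_eq_neg_fderiv_mul_of_integrable i1
      ((hφ.continuous.mul (hDD u hu i)).integrable_of_hasCompactSupport hc.mul_right)
      ((hφ.continuous.mul (hD u hu i).continuous).integrable_of_hasCompactSupport hc.mul_right)
      (fun x _ => (hφ.differentiable (by norm_num)) x)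
      (fun x _ => ((hD u hu i).differentiable (by norm_num)) x),
      integral_mul_fderiv_eq_neg_fderiv_mul_of_integrable
      (((hDD φ hφ i).mul hu.continuous).integrable_of_hasCompactSupport (hcDD i).mul_right) i1
      (((hD φ hφ i).continuous.mul hu.continuous).integrable_of_hasCompactSupport
        (hcD i).mul_right)
      (fun x _ => ((hD φ hφ i).differentiable (by norm_num)) x)
      (fun x _ => (hu.differentiable (by norm_num)) x), neg_neg]
  simp only [lap_eq_sum_fderiv hu.contDiffAt, lap_eq_sum_fderiv hφ.contDiffAt, Finset.mul_sum,
    Finset.sum_mul]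
  rw [integral_finsetSum _ fun i _ => ?_, integral_finsetSum _ fun i _ => ?_]
  · exact Finset.sum_congr rfl fun i _ => key i
  · exact ((hDD φ hφ i).mul hu.continuous).integrable_of_hasCompactSupport (hcDD i).mul_right
  · exact (hφ.continuous.mul (hDD u hu i)).integrable_of_hasCompactSupport hc.mul_right

lemma negLapPow_zero (u : EuclideanSpace ℝ (Fin N) → ℝ) : negLapPow 0 u = u := rfl

lemma negLapPow_succ (k : ℕ) (u : EuclideanSpace ℝ (Fin N) → ℝ) :
    negLapPow (k + 1) u = fun x => -lap (negLapPow k u) x := by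
  unfold negLapPow
  rw [Function.iterate_succ_apply']

lemma negLapPow_succ_apply (k : ℕ) (u : EuclideanSpace ℝ (Fin N) → ℝ)
    (x : EuclideanSpace ℝ (Fin N)) : negLapPow (k + 1) u x = -lap (negLapPow k u) x := by
  rw [negLapPow_succ]

lemma negLapPow_succ' (k : ℕ) (u : EuclideanSpace ℝ (Fin N) → ℝ) :
    negLapPow (k + 1) u = negLapPow k (fun x => -lap u x) := by
  unfold negLapPow
  rw [Function.iterate_succ_apply]

lemma contDiff_negLapPow {k j : ℕ} {u : EuclideanSpace ℝ (Fin N) → ℝ}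
    (hu : ContDiff ℝ ((2 * k + j : ℕ) : WithTop ℕ∞) u) :
    ContDiff ℝ (j : WithTop ℕ∞) (negLapPow k u) := by
  induction k generalizing j with
  | zero => simpa [negLapPow_zero] using hu
  | succ k ih =>
    rw [negLapPow_succ]
    have h := ih (j := j + 2) (by convert hu using 2; ring)
    exact (contDiff_lap h (by norm_cast)).neg

lemma contDiff_infty_negLapPow (k : ℕ) {u : EuclideanSpace ℝ (Fin N) → ℝ}
    (hu : ContDiff ℝ ∞ u) : ContDiff ℝ ∞ (negLapPow k u) := by
  induction k with
  | zero => exact hu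
  | succ k ih =>
    rw [negLapPow_succ]
    exact (contDiff_lap ih (by rfl)).neg

lemma hasCompactSupport_lap {f : EuclideanSpace ℝ (Fin N) → ℝ} (hc : HasCompactSupport f) :
    HasCompactSupport (lap f) := by
  refine HasCompactSupport.of_support_subset_isCompact hc.isCompact fun x hx => ?_
  by_contra h
  refine hx ?_
  have h0 : f =ᶠ[𝓝 x] fun _ => 0 := notMem_tsupport_iff_eventuallyEq.1 h
  have h1 := (lap_congr_nhds h0).eq_of_nhds
  rw [h1, lap_eq_laplacian]
  simp

lemma hasCompactSupport_negLapPow (k : ℕ) {f : EuclideanSpace ℝ (Fin N) → ℝ}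
    (hc : HasCompactSupport f) : HasCompactSupport (negLapPow k f) := by
  induction k with
  | zero => exact hc
  | succ k ih =>
    rw [negLapPow_succ]
    exact (hasCompactSupport_lap ih).neg

lemma negLapPow_congr_nhds (k : ℕ) {f g : EuclideanSpace ℝ (Fin N) → ℝ}
    {x : EuclideanSpace ℝ (Fin N)} (h : f =ᶠ[𝓝 x] g) :
    negLapPow k f =ᶠ[𝓝 x] negLapPow k g := by
  induction k with
  | zero => exact h
  | succ k ih =>
    rw [negLapPow_succ, negLapPow_succ]
    exact (lap_congr_nhds ih).neg

lemma negLapPow_sub (k : ℕ) {f g : EuclideanSpace ℝ (Fin N) → ℝ} (hf : ContDiff ℝ ∞ f)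
    (hg : ContDiff ℝ ∞ g) :
    negLapPow k (fun x => f x - g x) = fun x => negLapPow k f x - negLapPow k g x := by
  induction k with
  | zero => rfl
  | succ k ih =>
    rw [negLapPow_succ, negLapPow_succ, negLapPow_succ, ih,
      lap_sub ((contDiff_infty_negLapPow k hf).of_le two_le_infty)
        ((contDiff_infty_negLapPow k hg).of_le two_le_infty)]
    ext x
    ring

lemma negLapPow_const_mul_comp_smul (k : ℕ) (a c : ℝ) {f : EuclideanSpace ℝ (Fin N) → ℝ}
    (hf : ContDiff ℝ ∞ f) :
    negLapPow k (fun x => a * f (c • x)) = fun x => a * c ^ (2 * k) * negLapPow k f (c • x) := by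
  induction k with
  | zero => simp [negLapPow_zero]
  | succ k ih =>
    rw [negLapPow_succ, negLapPow_succ, ih]
    have hs := contDiff_infty_negLapPow k hf
    ext x
    have h2 : ContDiffAt ℝ 2 (fun x => negLapPow k f (c • x)) x :=
      ((hs.of_le two_le_infty).comp (contDiff_const_smul c)).contDiffAt
    rw [lap_const_mul _ h2, lap_comp_smul]
    ring

lemma integral_mul_negLapPow (k : ℕ) {φ u : EuclideanSpace ℝ (Fin N) → ℝ} (hφ : ContDiff ℝ ∞ φ)
    (hc : HasCompactSupport φ) (hu : ContDiff ℝ ((2 * k : ℕ) : WithTop ℕ∞) u) :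
    ∫ x, φ x * negLapPow k u x = ∫ x, negLapPow k φ x * u x := by
  induction k generalizing u with
  | zero => rfl
  | succ k ih =>
    have hu' : ContDiff ℝ ((2 * k : ℕ) : WithTop ℕ∞) (fun x => -lap u x) :=
      (contDiff_lap hu (by norm_cast)).neg
    rw [negLapPow_succ', ih hu', negLapPow_succ]
    have h2 : ContDiff ℝ 2 u := hu.of_le (by norm_cast; lia)
    have := integral_mul_lap
      ((contDiff_infty_negLapPow k hφ).of_le two_le_infty)
      (hasCompactSupport_negLapPow k hc) h2
    simp only [mul_neg, neg_mul, integral_neg, this]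

end Laplacian

section RadialProfile

variable {N : ℕ}

lemma fderiv_norm_sq_rpow (b : ℝ) {x : EuclideanSpace ℝ (Fin N)} (hx : x ≠ 0) (i : Fin N) :
    fderiv ℝ (fun y : EuclideanSpace ℝ (Fin N) => (‖y‖ ^ 2) ^ b) x (EuclideanSpace.single i 1)
      = 2 * b * ((‖x‖ ^ 2) ^ (b - 1) * x i) := by
  have h1 : HasFDerivAt (fun y : EuclideanSpace ℝ (Fin N) => ‖y‖ ^ 2) (2 • innerSL ℝ x) x :=
    (hasStrictFDerivAt_norm_sq x).hasFDerivAt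
  have h2 := h1.rpow_const (p := b) (Or.inl (by positivity))
  rw [h2.fderiv]
  simp [EuclideanSpace.inner_single_right]
  ring

lemma contDiffAt_norm_sq_rpow (b : ℝ) {x : EuclideanSpace ℝ (Fin N)} (hx : x ≠ 0)
    {n : WithTop ℕ∞} :
    ContDiffAt ℝ n (fun y : EuclideanSpace ℝ (Fin N) => (‖y‖ ^ 2) ^ b) x :=
  (contDiff_norm_sq ℝ).contDiffAt.rpow_const_of_ne (by positivity)

lemma lap_norm_sq_rpow (b : ℝ) {x : EuclideanSpace ℝ (Fin N)} (hx : x ≠ 0) :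
    lap (fun y : EuclideanSpace ℝ (Fin N) => (‖y‖ ^ 2) ^ b) x
      = 2 * b * (2 * b - 2 + N) * (‖x‖ ^ 2) ^ (b - 1) := by
  rw [lap_eq_sum_fderiv (contDiffAt_norm_sq_rpow b hx)]
  have hev : ∀ᶠ y in 𝓝 x, y ≠ 0 := isOpen_ne.mem_nhds hx
  have key : ∀ i : Fin N, fderiv ℝ (fun y => fderiv ℝ
      (fun y : EuclideanSpace ℝ (Fin N) => (‖y‖ ^ 2) ^ b) y (EuclideanSpace.single i 1)) x
      (EuclideanSpace.single i 1)
      = 2 * b * (2 * (b - 1) * (‖x‖ ^ 2) ^ (b - 1 - 1) * (x i) ^ 2 + (‖x‖ ^ 2) ^ (b - 1)) := by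
    intro i
    have he : (fun y => fderiv ℝ (fun y : EuclideanSpace ℝ (Fin N) => (‖y‖ ^ 2) ^ b) y
        (EuclideanSpace.single i 1)) =ᶠ[𝓝 x]
        fun y => 2 * b * ((‖y‖ ^ 2) ^ (b - 1) * y i) := by
      filter_upwards [hev] with y hy using fderiv_norm_sq_rpow b hy i
    have hc : HasFDerivAt (fun y : EuclideanSpace ℝ (Fin N) => y i)
        (EuclideanSpace.proj i : EuclideanSpace ℝ (Fin N) →L[ℝ] ℝ) x :=
      (EuclideanSpace.proj i : EuclideanSpace ℝ (Fin N) →L[ℝ] ℝ).hasFDerivAt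
    have hd : HasFDerivAt (fun y : EuclideanSpace ℝ (Fin N) => (‖y‖ ^ 2) ^ (b - 1)) _ x :=
      ((contDiffAt_norm_sq_rpow (b - 1) hx (n := 1)).differentiableAt (by norm_num)).hasFDerivAt
    have hm : HasFDerivAt (fun y : EuclideanSpace ℝ (Fin N) =>
        2 * b * ((‖y‖ ^ 2) ^ (b - 1) * y i)) _ x := (hd.mul hc).const_mul (2 * b)
    rw [he.fderiv_eq, hm.fderiv]
    have h1 : (EuclideanSpace.proj i : EuclideanSpace ℝ (Fin N) →L[ℝ] ℝ)
        (EuclideanSpace.single i (1 : ℝ)) = 1 := by simp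
    simp only [_root_.smul_apply, _root_.add_apply, smul_eq_mul, fderiv_norm_sq_rpow (b - 1) hx i,
      h1]
    ring
  have hs : ∑ i, (x i) ^ 2 = ‖x‖ ^ 2 := by
    rw [EuclideanSpace.norm_sq_eq]
    simp
  have hp : (‖x‖ ^ 2) ^ (b - 1 - 1) * ‖x‖ ^ 2 = (‖x‖ ^ 2) ^ (b - 1) := by
    have h0 : 0 < ‖x‖ ^ 2 := by positivity
    rw [Real.rpow_sub_one h0.ne', div_mul_cancel₀ _ h0.ne']
  rw [Finset.sum_congr rfl fun i _ => key i, ← Finset.mul_sum, Finset.sum_add_distrib,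
    ← Finset.mul_sum, hs]
  simp only [Finset.sum_const, Finset.card_univ, Fintype.card_fin, nsmul_eq_mul]
  rw [mul_assoc (2 * (b - 1)), hp]
  ring

lemma lap_of_eq_norm_sq_rpow {g : EuclideanSpace ℝ (Fin N) → ℝ} {a b : ℝ}
    (hg : ∀ x, x ≠ 0 → g x = a * (‖x‖ ^ 2) ^ b) {x : EuclideanSpace ℝ (Fin N)} (hx : x ≠ 0) :
    lap g x = a * (2 * b * (2 * b - 2 + N)) * (‖x‖ ^ 2) ^ (b - 1) := by
  have he : g =ᶠ[𝓝 x] fun y => a * (‖y‖ ^ 2) ^ b := by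
    filter_upwards [isOpen_ne.mem_nhds hx] with y hy using hg y hy
  rw [(lap_congr_nhds he).eq_of_nhds, lap_const_mul a (contDiffAt_norm_sq_rpow b hx),
    lap_norm_sq_rpow b hx]
  ring

lemma exists_negLapPow_norm_sq_rpow (b : ℝ) (k : ℕ) : ∃ a : ℝ, ∀ x : EuclideanSpace ℝ (Fin N),
    x ≠ 0 → negLapPow k (fun y : EuclideanSpace ℝ (Fin N) => (‖y‖ ^ 2) ^ b) x
      = a * (‖x‖ ^ 2) ^ (b - k) := by
  induction k with
  | zero => exact ⟨1, fun x _ => by simp [negLapPow_zero]⟩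
  | succ k ih =>
    obtain ⟨a, ha⟩ := ih
    refine ⟨-(a * (2 * (b - k) * (2 * (b - k) - 2 + N))), fun x hx => ?_⟩
    rw [negLapPow_succ_apply, lap_of_eq_norm_sq_rpow ha hx]
    push_cast
    rw [sub_sub]
    ring

/-- The fundamental solution `|x|^(2m-N)` of `(-Δ)^m` is polyharmonic away from the origin. -/
lemma negLapPow_fundamental {m : ℕ} (hm : 1 ≤ m) {x : EuclideanSpace ℝ (Fin N)} (hx : x ≠ 0) :
    negLapPow m (fun y : EuclideanSpace ℝ (Fin N) => (‖y‖ ^ 2) ^ (m - N / 2 : ℝ)) x = 0 := by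
  obtain ⟨k, rfl⟩ : ∃ k, m = k + 1 := ⟨m - 1, by lia⟩
  obtain ⟨a, ha⟩ := exists_negLapPow_norm_sq_rpow (N := N) (((k + 1 : ℕ) : ℝ) - N / 2) k
  rw [negLapPow_succ_apply, lap_of_eq_norm_sq_rpow ha hx]
  push_cast
  ring

lemma negLapPow_const {m : ℕ} (hm : 1 ≤ m) (c : ℝ) (x : EuclideanSpace ℝ (Fin N)) :
    negLapPow m (fun _ : EuclideanSpace ℝ (Fin N) => c) x = 0 := by
  induction m, hm using Nat.le_induction generalizing x with
  | base => rw [negLapPow_succ, negLapPow_zero, lap_eq_laplacian]; simp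
  | succ k _ ih =>
    rw [negLapPow_succ, show negLapPow k (fun _ : EuclideanSpace ℝ (Fin N) => c) = fun _ => 0 from
      funext ih, lap_eq_laplacian]
    simp

/-- A smooth function agreeing with `|x|^(2m-N)` outside the ball of radius `2` and constant on
the unit ball. -/
lemma exists_profile {m d : ℕ} (hm : 1 ≤ m) (hd : N = 2 * m + d) :
    ∃ (Φ : EuclideanSpace ℝ (Fin N) → ℝ) (c C : ℝ), 0 < c ∧ 0 ≤ C ∧ ContDiff ℝ ∞ Φ ∧
      (∀ x, ‖x‖ ≤ 1 → Φ x = c) ∧ (∀ x, ‖x‖ ≤ 2 → c ≤ Φ x) ∧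
      (∀ x, 2 ≤ ‖x‖ → Φ x * ‖x‖ ^ d = 1) ∧ (∀ x, x ≠ 0 → Φ x * ‖x‖ ^ d ≤ 1) ∧
      (∀ x, |negLapPow m Φ x| ≤ C) ∧ (∀ x, ‖x‖ < 1 ∨ 2 < ‖x‖ → negLapPow m Φ x = 0) := by
  let χ : ContDiffBump (0 : EuclideanSpace ℝ (Fin N)) := ⟨1, 2, one_pos, one_lt_two⟩
  set h : EuclideanSpace ℝ (Fin N) → ℝ := fun y => (‖y‖ ^ 2) ^ (m - N / 2 : ℝ) with hh
  have hb : (m - N / 2 : ℝ) = -(d / 2 : ℝ) := by rw [hd]; push_cast; ring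
  have hmul : ∀ x, x ≠ 0 → h x * ‖x‖ ^ d = 1 := by
    intro x hx
    have h0 : 0 < ‖x‖ := norm_pos_iff.2 hx
    have h3 : (‖x‖ ^ 2) ^ (d / 2 : ℝ) = ‖x‖ ^ d := by
      rw [← Real.rpow_natCast ‖x‖ 2, ← Real.rpow_mul h0.le, ← Real.rpow_natCast ‖x‖ d]
      congr 1
      push_cast
      ring
    rw [hh]
    simp only
    rw [hb, Real.rpow_neg (by positivity), h3, inv_mul_cancel₀ (by positivity)]
  set c : ℝ := (2 ^ d)⁻¹ with hc
  have hc0 : 0 < c := by positivity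
  have hle : ∀ x, x ≠ 0 → ‖x‖ ≤ 2 → c ≤ h x := by
    intro x hx hx2
    have h0 : 0 < ‖x‖ := norm_pos_iff.2 hx
    rw [hc, eq_inv_of_mul_eq_one_left (hmul x hx)]
    gcongr
  set Φ : EuclideanSpace ℝ (Fin N) → ℝ := fun x => h x * (1 - χ x) + c * χ x with hΦ
  have hone : ∀ x, ‖x‖ ≤ 1 → Φ x = c := by
    intro x hx
    have : χ x = 1 := χ.one_of_mem_closedBall (by simpa [χ] using hx)
    simp [hΦ, this]
  have htwo : ∀ x, 2 ≤ ‖x‖ → Φ x = h x := by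
    intro x hx
    have : χ x = 0 := χ.zero_of_le_dist (by simpa [χ] using hx)
    simp [hΦ, this]
  have hsmooth : ContDiff ℝ ∞ Φ := by
    rw [contDiff_iff_contDiffAt]
    intro x
    by_cases hx : x = 0
    · have : Φ =ᶠ[𝓝 x] fun _ => c := by
        filter_upwards [ball_mem_nhds x one_pos] with y hy
        refine hone y ?_
        rw [hx] at hy
        simpa using (mem_ball.1 hy).le
      exact contDiffAt_const.congr_of_eventuallyEq this
    · exact ((contDiffAt_norm_sq_rpow _ hx).mul (contDiffAt_const.sub χ.contDiffAt)).add
        (contDiffAt_const.mul χ.contDiffAt)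
  have hzero : ∀ x, ‖x‖ < 1 ∨ 2 < ‖x‖ → negLapPow m Φ x = 0 := by
    rintro x (hx | hx)
    · have : Φ =ᶠ[𝓝 x] fun _ => c := by
        filter_upwards [(isOpen_lt continuous_norm continuous_const).mem_nhds hx] with y hy
        exact hone y (le_of_lt hy)
      rw [(negLapPow_congr_nhds m this).eq_of_nhds, negLapPow_const hm]
    · have : Φ =ᶠ[𝓝 x] h := by
        filter_upwards [(isOpen_lt continuous_const continuous_norm).mem_nhds hx] with y hy
        exact htwo y (le_of_lt hy)
      rw [(negLapPow_congr_nhds m this).eq_of_nhds,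
        negLapPow_fundamental hm (by rintro rfl; norm_num at hx)]
  have hcont : Continuous (negLapPow m Φ) := (contDiff_infty_negLapPow m hsmooth).continuous
  obtain ⟨C, hC⟩ := (isCompact_closedBall (0 : EuclideanSpace ℝ (Fin N)) 2).exists_bound_of_continuousOn
    hcont.continuousOn
  have hC0 : 0 ≤ C := (norm_nonneg _).trans (hC 0 (by simp))
  refine ⟨Φ, c, C, hc0, hC0, hsmooth, hone, ?_, ?_, ?_, ?_, hzero⟩
  · intro x hx
    by_cases h0 : x = 0
    · rw [hone x (by simp [h0])]
    · have := hle x h0 hx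
      have h1 := χ.le_one (x := x)
      simp only [hΦ]
      nlinarith
  · intro x hx
    rw [htwo x hx, hmul x (by rintro rfl; norm_num at hx)]
  · intro x hx
    rcases le_total 2 ‖x‖ with h2 | h2
    · rw [htwo x h2, hmul x hx]
    · rw [← hmul x hx]
      have := hle x hx h2
      have h1 := χ.nonneg (x := x)
      have : Φ x ≤ h x := by
        simp only [hΦ]
        nlinarith
      gcongr
  · intro x
    by_cases hx : ‖x‖ ≤ 2
    · exact hC x (by simpa using hx)
    · rw [hzero x (Or.inr (not_le.1 hx))]
      simpa using hC0

end RadialProfile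

section KeyEstimate

variable {N : ℕ}

/-- The closed shell `R ≤ |x| ≤ 2R`. -/
def closedShell (N : ℕ) (R : ℝ) : Set (EuclideanSpace ℝ (Fin N)) :=
  {x | R ≤ ‖x‖ ∧ ‖x‖ ≤ 2 * R}

lemma closedShell_subset_closedBall (R : ℝ) : closedShell N R ⊆ closedBall 0 (2 * R) := by
  intro x hx
  simpa using hx.2

lemma isCompact_closedShell (R : ℝ) : IsCompact (closedShell N R) := by
  refine (isCompact_closedBall 0 (2 * R)).of_isClosed_subset ?_ (closedShell_subset_closedBall R)
  exact (isClosed_le continuous_const continuous_norm).inter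
    (isClosed_le continuous_norm continuous_const)

lemma measurableSet_closedShell (R : ℝ) : MeasurableSet (closedShell N R) :=
  (isCompact_closedShell R).isClosed.measurableSet

lemma abs_scaled_mul_le {L : EuclideanSpace ℝ (Fin N) → ℝ} {C : ℝ}
    (hC : ∀ x, |L x| ≤ C) (h0 : ∀ x, ‖x‖ < 1 ∨ 2 < ‖x‖ → L x = 0)
    {u : EuclideanSpace ℝ (Fin N) → ℝ} (hu : ∀ x, 0 ≤ u x) {R : ℝ} (hR : 0 < R)
    (x : EuclideanSpace ℝ (Fin N)) :
    |L (R⁻¹ • x)| * u x ≤ C * (closedShell N R).indicator u x := by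
  have hn : ‖R⁻¹ • x‖ = ‖x‖ / R := by
    rw [norm_smul, norm_inv, Real.norm_of_nonneg hR.le]
    ring
  by_cases hx : x ∈ closedShell N R
  · rw [Set.indicator_of_mem hx]
    exact mul_le_mul_of_nonneg_right (hC _) (hu x)
  · rw [Set.indicator_of_notMem hx, h0, abs_zero, zero_mul, mul_zero]
    rw [hn, div_lt_one hR, lt_div_iff₀ hR]
    by_contra! h
    exact hx h

lemma exists_truncated_testFunction {m d : ℕ} (hm : 1 ≤ m) (hd : 1 ≤ d) (hN : N = 2 * m + d) :
    ∃ c C : ℝ, 0 < c ∧ 0 ≤ C ∧ ∀ R ρ : ℝ, 0 < R → 2 * R ≤ ρ →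
      ∃ φ : EuclideanSpace ℝ (Fin N) → ℝ, ContDiff ℝ ∞ φ ∧ HasCompactSupport φ ∧
        (∀ x, 0 ≤ φ x) ∧ (∀ x, ‖x‖ ≤ 2 * R → c * (R ^ d)⁻¹ ≤ φ x) ∧
        ∀ u : EuclideanSpace ℝ (Fin N) → ℝ, (∀ x, 0 ≤ u x) → ∀ x,
          negLapPow m φ x * u x ≤ C * ((R ^ N)⁻¹ * (closedShell N R).indicator u x)
            + C * ((ρ ^ N)⁻¹ * (closedShell N ρ).indicator u x) := by
  obtain ⟨Φ, c, C, hc, hC, hsm, hone, hge, hout, hle, hbd, hzero⟩ :=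
    exists_profile (N := N) hm hN
  refine ⟨c / 2, C, by positivity, hC, fun R ρ hR hρR => ?_⟩
  have hρ : 0 < ρ := by linarith
  have hpow : (ρ ^ d)⁻¹ ≤ (R ^ d)⁻¹ / 2 := by
    have h1 : 2 * R ^ d ≤ ρ ^ d := by
      calc 2 * R ^ d ≤ 2 ^ d * R ^ d := by
            gcongr
            exact le_self_pow₀ (by norm_num) (by lia)
        _ = (2 * R) ^ d := by rw [mul_pow]
        _ ≤ ρ ^ d := by gcongr
    calc (ρ ^ d)⁻¹ ≤ (2 * R ^ d)⁻¹ := by gcongr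
      _ = (R ^ d)⁻¹ / 2 := by rw [mul_inv]; ring
  have hn : ∀ r : ℝ, 0 < r → ∀ x : EuclideanSpace ℝ (Fin N), ‖r⁻¹ • x‖ = ‖x‖ / r := by
    intro r hr x
    rw [norm_smul, norm_inv, Real.norm_of_nonneg hr.le]
    ring
  have hmulpow : ∀ r : ℝ, 0 < r → ∀ x : EuclideanSpace ℝ (Fin N),
      (r ^ d)⁻¹ * Φ (r⁻¹ • x) * ‖x‖ ^ d = Φ (r⁻¹ • x) * ‖r⁻¹ • x‖ ^ d := by
    intro r hr x
    rw [hn r hr, div_pow]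
    ring
  have hinner : ∀ x : EuclideanSpace ℝ (Fin N), ‖x‖ ≤ 2 * R → c / 2 * (R ^ d)⁻¹ ≤
      (R ^ d)⁻¹ * Φ (R⁻¹ • x) - (ρ ^ d)⁻¹ * Φ (ρ⁻¹ • x) := by
    intro x hx
    have h1 := hge (R⁻¹ • x) (by rw [hn R hR]; exact (div_le_iff₀ hR).2 hx)
    have h2 := hone (ρ⁻¹ • x) (by rw [hn ρ hρ]; exact (div_le_one hρ).2 (hx.trans hρR))
    rw [h2]
    have h3 : (R ^ d)⁻¹ * c ≤ (R ^ d)⁻¹ * Φ (R⁻¹ • x) := by gcongr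
    nlinarith
  have hsmR : ∀ r : ℝ, ContDiff ℝ ∞ (fun x : EuclideanSpace ℝ (Fin N) =>
      (r ^ d)⁻¹ * Φ (r⁻¹ • x)) := fun r =>
    contDiff_const.mul (hsm.comp (contDiff_const_smul _))
  refine ⟨fun x => (R ^ d)⁻¹ * Φ (R⁻¹ • x) - (ρ ^ d)⁻¹ * Φ (ρ⁻¹ • x),
    (hsmR R).sub (hsmR ρ), ?_, ?_, hinner, ?_⟩
  · refine HasCompactSupport.intro (isCompact_closedBall 0 (2 * ρ)) fun x hx => ?_
    have hx' : 2 * ρ < ‖x‖ := by simpa using hx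
    have hx0 : ‖x‖ ^ d ≠ 0 := by
      have : 0 < ‖x‖ := by linarith
      positivity
    have h1 := hout (R⁻¹ • x) (by rw [hn R hR, le_div_iff₀ hR]; linarith)
    have h2 := hout (ρ⁻¹ • x) (by rw [hn ρ hρ, le_div_iff₀ hρ]; linarith)
    rw [← hmulpow R hR] at h1
    rw [← hmulpow ρ hρ] at h2
    exact sub_eq_zero.2 (mul_right_cancel₀ hx0 (h1.trans h2.symm))
  · intro x
    rcases le_total ‖x‖ (2 * R) with hx | hx
    · exact le_trans (by positivity) (hinner x hx)
    · have hx0 : 0 < ‖x‖ := by linarith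
      have h1 := hout (R⁻¹ • x) (by rw [hn R hR, le_div_iff₀ hR]; linarith)
      have h2 := hle (ρ⁻¹ • x) (smul_ne_zero (by positivity) (norm_pos_iff.1 hx0))
      rw [← hmulpow R hR] at h1
      rw [← hmulpow ρ hρ] at h2
      exact sub_nonneg.2 (le_of_mul_le_mul_right (h2.trans h1.symm.le) (by positivity))
  · intro u hu x
    have hscale : ∀ r : ℝ, 0 < r → (r ^ d)⁻¹ * r⁻¹ ^ (2 * m) = (r ^ N)⁻¹ := by
      intro r hr
      rw [inv_pow, ← mul_inv, ← pow_add, hN, add_comm]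
    rw [negLapPow_sub m (hsmR R) (hsmR ρ), negLapPow_const_mul_comp_smul m _ _ hsm,
      negLapPow_const_mul_comp_smul m _ _ hsm, hscale R hR, hscale ρ hρ]
    simp only
    have h1 := abs_scaled_mul_le hbd hzero hu hR x
    have h2 := abs_scaled_mul_le hbd hzero hu hρ x
    have h3 : negLapPow m Φ (R⁻¹ • x) * u x ≤ |negLapPow m Φ (R⁻¹ • x)| * u x :=
      mul_le_mul_of_nonneg_right (le_abs_self _) (hu x)
    have h4 : -negLapPow m Φ (ρ⁻¹ • x) * u x ≤ |negLapPow m Φ (ρ⁻¹ • x)| * u x :=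
      mul_le_mul_of_nonneg_right (neg_le_abs _) (hu x)
    have h5 := mul_le_mul_of_nonneg_left (h3.trans h1) (by positivity : 0 ≤ (R ^ N)⁻¹)
    have h6 := mul_le_mul_of_nonneg_left (h4.trans h2) (by positivity : 0 ≤ (ρ ^ N)⁻¹)
    linarith

/-- If `u ≥ 0`, `(-Δ)^m u ≥ 0` and the means of `u` over large shells tend to zero, then the mass
of `(-Δ)^m u` in a ball is controlled by the mean of `u` over a shell of comparable radius. -/
lemma exists_setIntegral_negLapPow_le {m d : ℕ} (hm : 1 ≤ m) (hd : 1 ≤ d)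
    (hN : N = 2 * m + d) :
    ∃ K : ℝ, 0 < K ∧ ∀ u : EuclideanSpace ℝ (Fin N) → ℝ,
      ContDiff ℝ ((2 * m : ℕ) : WithTop ℕ∞) u → (∀ x, 0 ≤ u x) → (∀ x, 0 ≤ negLapPow m u x) →
      Tendsto (fun ρ : ℝ => (ρ ^ N)⁻¹ * ∫ x in closedShell N ρ, u x) atTop (𝓝 0) →
      ∀ R : ℝ, 0 < R → ∫ x in closedBall 0 (2 * R), negLapPow m u x
        ≤ K * ((R ^ (2 * m))⁻¹ * ∫ x in closedShell N R, u x) := by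
  obtain ⟨c, C, hc, hC, H⟩ := exists_truncated_testFunction (N := N) hm hd hN
  refine ⟨(C + 1) / c, by positivity, fun u hu hu0 hf0 hlim R hR => ?_⟩
  have hucont : Continuous u := hu.continuous
  have hfcont : Continuous (negLapPow m u) :=
    (contDiff_negLapPow (k := m) (j := 0) (by simpa using hu)).continuous
  have hint : ∀ r, Integrable ((closedShell N r).indicator u) := fun r =>
    (hucont.continuousOn.integrableOn_compact (isCompact_closedShell r)).integrable_indicator
      (measurableSet_closedShell r)
  have hmain : ∀ ρ : ℝ, 2 * R ≤ ρ →
      c * (R ^ d)⁻¹ * ∫ x in closedBall 0 (2 * R), negLapPow m u x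
        ≤ C * ((R ^ N)⁻¹ * ∫ x in closedShell N R, u x)
          + C * ((ρ ^ N)⁻¹ * ∫ x in closedShell N ρ, u x) := by
    intro ρ hρ
    obtain ⟨φ, hφ, hφc, hφ0, hφR, hL⟩ := H R ρ hR hρ
    have hi : Integrable (fun x => φ x * negLapPow m u x) :=
      (hφ.continuous.mul hfcont).integrable_of_hasCompactSupport hφc.mul_right
    calc c * (R ^ d)⁻¹ * ∫ x in closedBall 0 (2 * R), negLapPow m u x
        = ∫ x in closedBall 0 (2 * R), c * (R ^ d)⁻¹ * negLapPow m u x :=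
          (integral_const_mul _ _).symm
      _ ≤ ∫ x in closedBall 0 (2 * R), φ x * negLapPow m u x := by
          refine setIntegral_mono_on ?_ hi.integrableOn measurableSet_closedBall fun x hx => ?_
          · exact (continuous_const.mul hfcont).continuousOn.integrableOn_compact
              (isCompact_closedBall _ _)
          · exact mul_le_mul_of_nonneg_right (hφR x (by simpa using hx)) (hf0 x)
      _ ≤ ∫ x, φ x * negLapPow m u x :=
          setIntegral_le_integral hi (Eventually.of_forall fun x => mul_nonneg (hφ0 x) (hf0 x))
      _ = ∫ x, negLapPow m φ x * u x := integral_mul_negLapPow m hφ hφc hu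
      _ ≤ ∫ x, (C * ((R ^ N)⁻¹ * (closedShell N R).indicator u x)
            + C * ((ρ ^ N)⁻¹ * (closedShell N ρ).indicator u x)) := by
          refine integral_mono ?_ ?_ fun x => hL u hu0 x
          · exact ((contDiff_infty_negLapPow m hφ).continuous.mul
              hucont).integrable_of_hasCompactSupport (hasCompactSupport_negLapPow m hφc).mul_right
          · exact (((hint R).const_mul _).const_mul _).add (((hint ρ).const_mul _).const_mul _)
      _ = _ := by
          rw [integral_add (((hint R).const_mul _).const_mul _) (((hint ρ).const_mul _).const_mul _)]
          simp only [integral_const_mul, integral_indicator (measurableSet_closedShell _)]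
  have hfinal : c * (R ^ d)⁻¹ * ∫ x in closedBall 0 (2 * R), negLapPow m u x
      ≤ C * ((R ^ N)⁻¹ * ∫ x in closedShell N R, u x) + C * 0 := by
    refine ge_of_tendsto (tendsto_const_nhds.add (hlim.const_mul C)) ?_
    filter_upwards [eventually_ge_atTop (2 * R)] with ρ hρ using hmain ρ hρ
  have hI : 0 ≤ ∫ x in closedShell N R, u x := integral_nonneg hu0
  have hsplit : (R ^ N)⁻¹ = (R ^ d)⁻¹ * (R ^ (2 * m))⁻¹ := by
    rw [← mul_inv, ← pow_add, hN, add_comm]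
  rw [hsplit, mul_zero, add_zero] at hfinal
  have hRd : 0 < (R ^ d)⁻¹ := by positivity
  have h1 : c * ∫ x in closedBall 0 (2 * R), negLapPow m u x
      ≤ C * ((R ^ (2 * m))⁻¹ * ∫ x in closedShell N R, u x) := by
    refine le_of_mul_le_mul_left ?_ hRd
    linarith
  have h2 : 0 ≤ (R ^ (2 * m))⁻¹ * ∫ x in closedShell N R, u x := by positivity
  rw [div_mul_eq_mul_div, le_div_iff₀ hc]
  linarith

end KeyEstimate

section Convolution

variable {N : ℕ}

lemma volume_real_closedShell {R : ℝ} (hR : 0 < R) :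
    volume.real (closedShell N R) = R ^ N * volume.real (closedShell N 1) := by
  have h : closedShell N R = R • closedShell N 1 := by
    ext x
    rw [Set.mem_smul_set_iff_inv_smul_mem₀ hR.ne']
    simp only [closedShell, Set.mem_ofPred_eq, norm_smul, norm_inv, Real.norm_of_nonneg hR.le]
    rw [inv_mul_eq_div, one_le_div hR, div_le_iff₀ hR, mul_one]
  rw [h, Measure.real, Measure.addHaar_smul]
  simp [Measure.real, abs_of_pos hR, hR.le]

lemma volume_real_closedShell_pos (hN : 0 < N) : 0 < volume.real (closedShell N 1) := by
  have hfin : volume (closedShell N 1) ≠ ⊤ := (isCompact_closedShell 1).measure_ne_top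
  refine ENNReal.toReal_pos (ne_of_gt ?_) hfin
  have hop : IsOpen {x : EuclideanSpace ℝ (Fin N) | 1 < ‖x‖ ∧ ‖x‖ < 2} :=
    (isOpen_lt continuous_const continuous_norm).inter (isOpen_lt continuous_norm continuous_const)
  refine (hop.measure_pos volume ?_).trans_le (measure_mono ?_)
  · refine ⟨EuclideanSpace.single ⟨0, hN⟩ (3 / 2), ?_⟩
    rw [Set.mem_ofPred_eq, PiLp.norm_single]
    norm_num
  · intro x hx
    exact ⟨hx.1.le, by linarith [hx.2]⟩

lemma integrable_rpow_mul_kernel {Ψ : ℝ → ℝ} (hK : CondK N Ψ) {p : ℝ} (hp : 0 ≤ p)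
    {v : EuclideanSpace ℝ (Fin N) → ℝ} (hv : Continuous v) (hv0 : ∀ x, 0 ≤ v x)
    (hint : IntegrableOn (fun y : EuclideanSpace ℝ (Fin N) => v y ^ p * Ψ (‖y‖ / 2))
      {y | 1 < ‖y‖}) (x : EuclideanSpace ℝ (Fin N)) :
    Integrable (fun y => v y ^ p * Ψ ‖y - x‖) := by
  have hvp : Continuous (fun y => v y ^ p) := hv.rpow_const fun _ => Or.inr hp
  have hmp := measurePreserving_sub_right (volume : Measure (EuclideanSpace ℝ (Fin N))) x
  set ρ : ℝ := 2 * ‖x‖ + 2 with hρ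
  rw [← integrableOn_univ, ← Set.union_compl_self (closedBall (0 : EuclideanSpace ℝ (Fin N)) ρ)]
  refine IntegrableOn.union ?_ ?_
  · have h1 : IntegrableOn (fun y => Ψ ‖y - x‖) (closedBall (0 : EuclideanSpace ℝ (Fin N)) ρ) := by
      have h2 := (hmp.integrableOn_comp_preimage
        (MeasurableEquiv.subRight x).measurableEmbedding).2
        (hK.locInt.integrableOn_isCompact (isCompact_closedBall 0 (ρ + ‖x‖)))
      refine h2.mono_set fun y hy => ?_
      have hy' : ‖y‖ ≤ ρ := by simpa using hy
      simpa using (norm_sub_le y x).trans (by linarith)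
    exact h1.continuousOn_mul hvp.continuousOn (isCompact_closedBall _ _)
  · have hsub : (closedBall (0 : EuclideanSpace ℝ (Fin N)) ρ)ᶜ ⊆ {y | 1 < ‖y‖} := by
      intro y hy
      have hy' : ρ < ‖y‖ := by simpa using hy
      have := norm_nonneg x
      simp only [Set.mem_ofPred_eq]
      linarith
    refine Integrable.mono' (hint.mono_set hsub) ?_ ?_
    · exact (hvp.aestronglyMeasurable.mul
        (hK.locInt.aestronglyMeasurable.comp_measurePreserving hmp)).restrict
    · filter_upwards [ae_restrict_mem measurableSet_closedBall.compl] with y hy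
      have hy' : ρ < ‖y‖ := by simpa using hy
      have hx0 := norm_nonneg x
      have h3 : ‖y‖ / 2 ≤ ‖y - x‖ := by
        have := norm_sub_norm_le y x
        linarith
      have h4 : 0 < ‖y‖ / 2 := by linarith
      have h5 := hK.anti (Set.mem_Ioi.2 h4) (Set.mem_Ioi.2 (h4.trans_le h3)) h3
      have h6 := Real.rpow_nonneg (hv0 y) p
      rw [Real.norm_of_nonneg (mul_nonneg h6 (hK.pos _ (h4.trans_le h3)).le)]
      exact mul_le_mul_of_nonneg_left h5 h6

lemma ae_ne_point (hN : 0 < N) (x : EuclideanSpace ℝ (Fin N)) : ∀ᵐ y, y ≠ x := by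
  have : NeZero N := ⟨hN.ne'⟩
  have : Nontrivial (EuclideanSpace ℝ (Fin N)) :=
    ⟨⟨EuclideanSpace.single 0 1, 0, by simp⟩⟩
  exact compl_mem_ae_iff.2 (measure_singleton x)

lemma integral_rpow_mul_kernel_nonneg (hN : 0 < N) {Ψ : ℝ → ℝ} (hK : CondK N Ψ) {p : ℝ}
    {v : EuclideanSpace ℝ (Fin N) → ℝ} (hv0 : ∀ x, 0 ≤ v x) (x : EuclideanSpace ℝ (Fin N)) :
    0 ≤ ∫ y, v y ^ p * Ψ ‖y - x‖ := by
  refine integral_nonneg_of_ae ?_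
  filter_upwards [ae_ne_point hN x] with y hy
  exact mul_nonneg (Real.rpow_nonneg (hv0 y) p)
    (hK.pos _ (norm_pos_iff.2 (sub_ne_zero.2 hy))).le

lemma kernel_mul_setIntegral_le (hN : 0 < N) {Ψ : ℝ → ℝ} (hK : CondK N Ψ) {p : ℝ} (hp : 0 ≤ p)
    {v : EuclideanSpace ℝ (Fin N) → ℝ} (hv : Continuous v) (hv0 : ∀ x, 0 ≤ v x)
    (hint : IntegrableOn (fun y : EuclideanSpace ℝ (Fin N) => v y ^ p * Ψ (‖y‖ / 2))
      {y | 1 < ‖y‖}) {ρ : ℝ} {S : Set (EuclideanSpace ℝ (Fin N))}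
    (hSc : IsCompact S) (hS : S ⊆ closedBall 0 ρ) {x : EuclideanSpace ℝ (Fin N)} (hx : x ∈ S) :
    Ψ (2 * ρ) * ∫ y in S, v y ^ p ≤ ∫ y, v y ^ p * Ψ ‖y - x‖ := by
  have hi := integrable_rpow_mul_kernel hK hp hv hv0 hint x
  have hvp : Continuous (fun y => v y ^ p) := hv.rpow_const fun _ => Or.inr hp
  have hx' : ‖x‖ ≤ ρ := by simpa using hS hx
  calc Ψ (2 * ρ) * ∫ y in S, v y ^ p = ∫ y in S, Ψ (2 * ρ) * v y ^ p :=
        (integral_const_mul _ _).symm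
    _ ≤ ∫ y in S, v y ^ p * Ψ ‖y - x‖ := by
        refine setIntegral_mono_on_ae ?_ hi.integrableOn hSc.measurableSet ?_
        · exact (continuous_const.mul hvp).continuousOn.integrableOn_compact hSc
        · filter_upwards [ae_ne_point hN x] with y hy hyS
          have hy' : ‖y‖ ≤ ρ := by simpa using hS hyS
          have h0 : 0 < ‖y - x‖ := norm_pos_iff.2 (sub_ne_zero.2 hy)
          have h1 : ‖y - x‖ ≤ 2 * ρ := (norm_sub_le y x).trans (by linarith)
          rw [mul_comm]
          exact mul_le_mul_of_nonneg_left
            (hK.anti (Set.mem_Ioi.2 h0) (Set.mem_Ioi.2 (h0.trans_le h1)) h1)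
            (Real.rpow_nonneg (hv0 y) p)
    _ ≤ ∫ y, v y ^ p * Ψ ‖y - x‖ := by
        refine setIntegral_le_integral hi ?_
        filter_upwards [ae_ne_point hN x] with y hy
        exact mul_nonneg (Real.rpow_nonneg (hv0 y) p)
          (hK.pos _ (norm_pos_iff.2 (sub_ne_zero.2 hy))).le

lemma kernel_mul_integral_mul_integral_le (hN : 0 < N) {Ψ : ℝ → ℝ} (hK : CondK N Ψ) {p q : ℝ}
    (hp : 0 ≤ p) (hq : 0 ≤ q) {v f : EuclideanSpace ℝ (Fin N) → ℝ} (hv : Continuous v)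
    (hv0 : ∀ x, 0 ≤ v x)
    (hint : IntegrableOn (fun y : EuclideanSpace ℝ (Fin N) => v y ^ p * Ψ (‖y‖ / 2))
      {y | 1 < ‖y‖})
    (hf : Continuous f) (hfv : ∀ x, (∫ y, v y ^ p * Ψ ‖y - x‖) * v x ^ q ≤ f x)
    {ρ : ℝ} {S : Set (EuclideanSpace ℝ (Fin N))}
    (hSc : IsCompact S) (hS : S ⊆ closedBall 0 ρ) :
    Ψ (2 * ρ) * ((∫ y in S, v y ^ p) * ∫ y in S, v y ^ q) ≤ ∫ x in S, f x := by
  have hvq : Continuous (fun y => v y ^ q) := hv.rpow_const fun _ => Or.inr hq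
  rw [← mul_assoc, ← integral_const_mul]
  refine setIntegral_mono_on ?_ (hf.continuousOn.integrableOn_compact hSc) hSc.measurableSet
    fun x hx => ?_
  · exact (continuous_const.mul hvq).continuousOn.integrableOn_compact hSc
  · exact (mul_le_mul_of_nonneg_right (kernel_mul_setIntegral_le hN hK hp hv hv0 hint hSc hS hx)
      (Real.rpow_nonneg (hv0 x) q)).trans (hfv x)

lemma tendsto_mean_closedShell (hN : 0 < N) {Ψ : ℝ → ℝ} (hK : CondK N Ψ) {p : ℝ} (hp : 1 ≤ p)
    {v : EuclideanSpace ℝ (Fin N) → ℝ} (hv : Continuous v) (hv0 : ∀ x, 0 ≤ v x)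
    (hint : IntegrableOn (fun y : EuclideanSpace ℝ (Fin N) => v y ^ p * Ψ (‖y‖ / 2))
      {y | 1 < ‖y‖}) :
    Tendsto (fun ρ : ℝ => (ρ ^ N)⁻¹ * ∫ x in closedShell N ρ, v x) atTop (𝓝 0) := by
  have hvp : Continuous (fun y => v y ^ p) := hv.rpow_const fun _ => Or.inr (by linarith)
  set V := volume.real (closedShell N 1) with hV
  have hV0 : 0 < V := volume_real_closedShell_pos hN
  set I := ∫ y in {y : EuclideanSpace ℝ (Fin N) | 1 < ‖y‖}, v y ^ p * Ψ (‖y‖ / 2) with hI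
  have hmain : ∀ ε : ℝ, 0 < ε → ∀ ρ : ℝ, 1 < ρ →
      (ρ ^ N)⁻¹ * ∫ x in closedShell N ρ, v x ≤ ε * V + ε ^ (1 - p) * I * (ρ ^ N * Ψ ρ)⁻¹ := by
    intro ε hε ρ hρ
    have hρ0 : 0 < ρ := by linarith
    have hΨ := hK.pos ρ hρ0
    have hpt : ∀ x, v x ≤ ε + ε ^ (1 - p) * v x ^ p := by
      intro x
      rcases le_total (v x) ε with h | h
      · have := Real.rpow_nonneg (hv0 x) p
        have := Real.rpow_nonneg hε.le (1 - p)
        have : 0 ≤ ε ^ (1 - p) * v x ^ p := by positivity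
        linarith
      · have hvx : 0 < v x := hε.trans_le h
        have h1 : v x ^ (1 - p) ≤ ε ^ (1 - p) :=
          Real.rpow_le_rpow_of_nonpos hε h (by linarith)
        have h2 : v x ^ (1 - p) * v x ^ p = v x := by
          rw [← Real.rpow_add hvx]
          simp
        have h3 := mul_le_mul_of_nonneg_right h1 (Real.rpow_nonneg (hv0 x) p)
        linarith
    have hA : Ψ ρ * ∫ x in closedShell N ρ, v x ^ p ≤ I := by
      have hsub : closedShell N ρ ⊆ {y : EuclideanSpace ℝ (Fin N) | 1 < ‖y‖} :=
        fun y hy => hρ.trans_le hy.1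
      rw [← integral_const_mul]
      calc ∫ x in closedShell N ρ, Ψ ρ * v x ^ p
          ≤ ∫ x in closedShell N ρ, v x ^ p * Ψ (‖x‖ / 2) := by
            refine setIntegral_mono_on ?_ (hint.mono_set hsub) (measurableSet_closedShell ρ)
              fun x hx => ?_
            · exact (continuous_const.mul hvp).continuousOn.integrableOn_compact
                (isCompact_closedShell ρ)
            · have h1 : 0 < ‖x‖ / 2 := by linarith [hx.1]
              have h2 : ‖x‖ / 2 ≤ ρ := by linarith [hx.2]
              rw [mul_comm]
              exact mul_le_mul_of_nonneg_left (hK.anti (Set.mem_Ioi.2 h1) (Set.mem_Ioi.2 hρ0) h2)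
                (Real.rpow_nonneg (hv0 x) p)
        _ ≤ I := by
            refine setIntegral_mono_set hint ?_ hsub.eventuallyLE
            filter_upwards [ae_restrict_mem (isOpen_lt continuous_const
              continuous_norm).measurableSet] with y hy
            have hy' : 1 < ‖y‖ := hy
            exact mul_nonneg (Real.rpow_nonneg (hv0 y) p) (hK.pos _ (by linarith)).le
    have hB : ∫ x in closedShell N ρ, v x
        ≤ ε * (ρ ^ N * V) + ε ^ (1 - p) * ∫ x in closedShell N ρ, v x ^ p := by
      have hi1 : IntegrableOn (fun _ : EuclideanSpace ℝ (Fin N) => ε) (closedShell N ρ) :=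
        continuous_const.continuousOn.integrableOn_compact (isCompact_closedShell ρ)
      have hi2 : IntegrableOn (fun x => ε ^ (1 - p) * v x ^ p) (closedShell N ρ) :=
        (continuous_const.mul hvp).continuousOn.integrableOn_compact (isCompact_closedShell ρ)
      calc ∫ x in closedShell N ρ, v x ≤ ∫ x in closedShell N ρ, (ε + ε ^ (1 - p) * v x ^ p) :=
            integral_mono (hv.continuousOn.integrableOn_compact (isCompact_closedShell ρ))
              (hi1.add hi2) hpt
        _ = _ := by
            rw [integral_add hi1 hi2, integral_const_mul, setIntegral_const,
              volume_real_closedShell hρ0, smul_eq_mul, mul_comm ε]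
    have hρN : 0 < ρ ^ N := by positivity
    have hC : ∫ x in closedShell N ρ, v x ^ p ≤ I * (Ψ ρ)⁻¹ := by
      rw [← div_eq_mul_inv, le_div_iff₀ hΨ, mul_comm]
      exact hA
    calc (ρ ^ N)⁻¹ * ∫ x in closedShell N ρ, v x
        ≤ (ρ ^ N)⁻¹ * (ε * (ρ ^ N * V) + ε ^ (1 - p) * (I * (Ψ ρ)⁻¹)) := by
          have := Real.rpow_nonneg hε.le (1 - p)
          gcongr
          exact hB.trans (by gcongr)
      _ = ε * V + ε ^ (1 - p) * I * (ρ ^ N * Ψ ρ)⁻¹ := by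
          rw [mul_inv]
          field_simp
  rw [tendsto_order]
  constructor
  · intro a ha
    filter_upwards [eventually_gt_atTop 0] with ρ hρ
    have : 0 ≤ ∫ x in closedShell N ρ, v x := integral_nonneg hv0
    exact ha.trans_le (by positivity)
  · intro a ha
    set ε := a / (2 * V) with hε
    have hε0 : 0 < ε := by positivity
    have h1 : Tendsto (fun ρ : ℝ => ε * V + ε ^ (1 - p) * I * (ρ ^ N * Ψ ρ)⁻¹) atTop
        (𝓝 (ε * V + ε ^ (1 - p) * I * 0)) :=
      tendsto_const_nhds.add ((tendsto_inv_atTop_zero.comp hK.tendsto).const_mul _)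
    have h2 : ε * V + ε ^ (1 - p) * I * 0 < a := by
      have : ε * V = a / 2 := by
        rw [hε]
        field_simp
      linarith
    filter_upwards [h1.eventually_lt_const h2, eventually_gt_atTop 1] with ρ hρ hρ1
    exact (hmain ε hε0 ρ hρ1).trans_lt hρ

end Convolution

section Liouville

lemma sq_mul_mean_rpow_le {X : Type*} [TopologicalSpace X] [T2Space X] [MeasurableSpace X]
    [OpensMeasurableSpace X] {μ : Measure X} [IsFiniteMeasureOnCompacts μ]
    {S : Set X} (hSc : IsCompact S) (hS : 0 < μ.real S) {v : X → ℝ} (hv : Continuous v)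
    (hv0 : ∀ x, 0 ≤ v x) {p q : ℝ} (hp : 0 ≤ p) (hq : 0 ≤ q) (hpq : 2 ≤ p + q) :
    μ.real S ^ 2 * ((∫ x in S, v x ∂μ) / μ.real S) ^ (p + q)
      ≤ (∫ x in S, v x ^ p ∂μ) * ∫ x in S, v x ^ q ∂μ := by
  set V := μ.real S with hV
  set a := (∫ x in S, v x ∂μ) / V with ha
  have hI0 : 0 ≤ ∫ x in S, v x ∂μ := integral_nonneg hv0
  have hP0 : 0 ≤ ∫ x in S, v x ^ p ∂μ := integral_nonneg fun x => Real.rpow_nonneg (hv0 x) p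
  have hQ0 : 0 ≤ ∫ x in S, v x ^ q ∂μ := integral_nonneg fun x => Real.rpow_nonneg (hv0 x) q
  rcases hI0.eq_or_lt with h0 | hpos
  · rw [ha, ← h0, zero_div, Real.zero_rpow (by linarith), mul_zero]
    positivity
  have ha0 : 0 < a := div_pos hpos hS
  have hint : ∀ {f : X → ℝ}, Continuous f → IntegrableOn f S μ := fun hf =>
    hf.continuousOn.integrableOn_compact' hSc hSc.measurableSet
  set s := (p + q) / 2 with hs
  have hs1 : 1 ≤ s := by linarith
  have hvs : Continuous fun x => v x ^ s := hv.rpow_const fun _ => Or.inr (by linarith)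
  have hvp : Continuous fun x => v x ^ p := hv.rpow_const fun _ => Or.inr hp
  have hvq : Continuous fun x => v x ^ q := hv.rpow_const fun _ => Or.inr hq
  have hjensen : V * a ^ s ≤ ∫ x in S, v x ^ s ∂μ := by
    have hpt : ∀ x, a ^ s * (1 - s + s / a * v x) ≤ v x ^ s := by
      intro x
      have hva : 0 ≤ v x / a := div_nonneg (hv0 x) ha0.le
      have h1 := one_add_mul_self_le_rpow_one_add (s := v x / a - 1) (by linarith) hs1
      rw [add_sub_cancel, Real.div_rpow (hv0 x) ha0.le, le_div_iff₀ (Real.rpow_pos_of_pos ha0 s)]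
        at h1
      calc _ = (1 + s * (v x / a - 1)) * a ^ s := by ring
        _ ≤ _ := h1
    calc V * a ^ s = ∫ x in S, a ^ s * (1 - s + s / a * v x) ∂μ := by
          rw [integral_const_mul, integral_add (hint continuous_const)
            ((hint hv).const_mul (s / a)), setIntegral_const, integral_const_mul, smul_eq_mul,
            ← hV]
          have : ∫ x in S, v x ∂μ = a * V := by
            rw [ha]
            field_simp
          rw [this]
          field_simp
          ring
      _ ≤ _ := integral_mono (hint (by fun_prop)) (hint hvs) hpt
  have hmul : ∀ x, v x ^ (p / 2) * v x ^ (q / 2) = v x ^ s := by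
    intro x
    rw [← Real.rpow_add_of_nonneg (hv0 x) (by positivity) (by positivity), hs, add_div]
  have hsq : ∀ x {r : ℝ}, v x ^ (r / 2) * v x ^ (r / 2) = v x ^ r := by
    intro x r
    rw [← sq, ← Real.rpow_mul_natCast (hv0 x)]
    congr 1
    push_cast
    ring
  have hquad : ∀ t : ℝ, 0 ≤ (∫ x in S, v x ^ p ∂μ) * (t * t)
      + (-2 * ∫ x in S, v x ^ s ∂μ) * t + ∫ x in S, v x ^ q ∂μ := by
    intro t
    have hi1 := (hint hvp).const_mul (t * t)
    have hi2 := (hint hvs).const_mul (-2 * t)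
    have h : ∫ x in S, (t * t * v x ^ p + -2 * t * v x ^ s + v x ^ q) ∂μ
        = (∫ x in S, v x ^ p ∂μ) * (t * t)
          + (-2 * ∫ x in S, v x ^ s ∂μ) * t + ∫ x in S, v x ^ q ∂μ := by
      rw [integral_add (hi1.fun_add hi2) (hint hvq), integral_add hi1 hi2, integral_const_mul,
        integral_const_mul]
      ring
    rw [← h]
    refine integral_nonneg fun x => ?_
    have h2 : t * t * v x ^ p + -2 * t * v x ^ s + v x ^ q
        = (t * v x ^ (p / 2) - v x ^ (q / 2)) ^ 2 := by
      rw [← hmul, ← hsq x (r := p), ← hsq x (r := q)]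
      ring
    simp only [Pi.zero_apply, h2]
    positivity
  have hdisc := discrim_le_zero hquad
  rw [discrim] at hdisc
  have has : a ^ (p + q) = a ^ s * a ^ s := by
    rw [← Real.rpow_add ha0, hs, add_halves]
  have hVa : 0 ≤ V * a ^ s := mul_nonneg hS.le (Real.rpow_nonneg ha0.le s)
  rw [has]
  nlinarith [mul_self_le_mul_self hVa hjensen]

lemma exists_mul_rpow_le_setIntegral_closedShell {N m : ℕ} (hN : 0 < N) {p q c : ℝ}
    (hp : 0 ≤ p) (hq : 0 ≤ q) (hpq : 2 ≤ p + q) (hc : 0 < c) :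
    ∃ c' : ℝ, 0 < c' ∧ ∀ Ψ : ℝ → ℝ, CondK N Ψ → ∀ v f : EuclideanSpace ℝ (Fin N) → ℝ,
      Continuous v → (∀ x, 0 ≤ v x) →
      IntegrableOn (fun y : EuclideanSpace ℝ (Fin N) => v y ^ p * Ψ (‖y‖ / 2)) {y | 1 < ‖y‖} →
      Continuous f → (∀ x, (∫ y, v y ^ p * Ψ ‖y - x‖) * v x ^ q ≤ f x) →
      ∀ R : ℝ, 0 < R → c ≤ (4 * R) ^ (2 * (N : ℝ) - ((N : ℝ) - 2 * m) * (p + q)) * Ψ (4 * R) →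
      c' * ((R ^ (2 * m))⁻¹ * ∫ x in closedShell N R, v x) ^ (p + q)
        ≤ ∫ x in closedShell N R, f x := by
  set V := volume.real (closedShell N 1) with hV
  have hV0 : 0 < V := volume_real_closedShell_pos hN
  set κ : ℝ := 2 * (N : ℝ) - ((N : ℝ) - 2 * m) * (p + q) with hκ
  have h4 : (0 : ℝ) < 4 ^ (-κ) := Real.rpow_pos_of_pos (by norm_num) _
  refine ⟨V ^ 2 * V ^ (-(p + q)) * (4 ^ (-κ) * c), by positivity, ?_⟩
  intro Ψ hK v f hv hv0 hint hf hfv R hR hcR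
  have hΨ : 4 ^ (-κ) * c ≤ R ^ κ * Ψ (4 * R) := by
    calc (4 : ℝ) ^ (-κ) * c ≤ 4 ^ (-κ) * ((4 * R) ^ κ * Ψ (4 * R)) := by gcongr
      _ = 4 ^ (-κ) * 4 ^ κ * (R ^ κ * Ψ (4 * R)) := by
          rw [Real.mul_rpow (by norm_num) hR.le]
          ring
      _ = R ^ κ * Ψ (4 * R) := by
          rw [← Real.rpow_add (by norm_num)]
          simp
  have hRN : 0 < R ^ N := by positivity
  have hvol := volume_real_closedShell (N := N) hR
  rw [← hV] at hvol
  set A := (R ^ (2 * m))⁻¹ * ∫ x in closedShell N R, v x with hA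
  have hA0 : 0 ≤ A := mul_nonneg (by positivity) (integral_nonneg hv0)
  have hcs := sq_mul_mean_rpow_le (μ := volume) (isCompact_closedShell R)
    (by rw [hvol]; positivity) hv hv0 hp hq hpq
  have hmean : (∫ x in closedShell N R, v x) / volume.real (closedShell N R)
      = V⁻¹ * R ^ (2 * (m : ℝ) - N) * A := by
    rw [hvol, hA, Real.rpow_sub hR, Real.rpow_natCast,
      show (2 * (m : ℝ)) = ((2 * m : ℕ) : ℝ) by push_cast; ring, Real.rpow_natCast]
    field_simp
  have hpow : (V⁻¹ * R ^ (2 * (m : ℝ) - N) * A) ^ (p + q)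
      = V ^ (-(p + q)) * R ^ ((2 * (m : ℝ) - N) * (p + q)) * A ^ (p + q) := by
    rw [Real.mul_rpow (by positivity) hA0, Real.mul_rpow (by positivity) (by positivity),
      ← Real.rpow_mul hR.le, Real.inv_rpow hV0.le, Real.rpow_neg hV0.le]
  have hexp : (R ^ N) ^ 2 * R ^ ((2 * (m : ℝ) - N) * (p + q)) = R ^ κ := by
    rw [← pow_mul, ← Real.rpow_natCast, ← Real.rpow_add hR]
    congr 1
    rw [hκ]
    push_cast
    ring
  have hker := kernel_mul_integral_mul_integral_le hN hK hp hq hv hv0 hint hf hfv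
    (isCompact_closedShell R) (closedShell_subset_closedBall R)
  rw [show 2 * (2 * R) = 4 * R by ring] at hker
  rw [hmean, hpow, hvol] at hcs
  have hΨ0 := (hK.pos (4 * R) (by linarith)).le
  have hAs := Real.rpow_nonneg hA0 (p + q)
  have hVs : 0 ≤ V ^ 2 * V ^ (-(p + q)) := by positivity
  calc V ^ 2 * V ^ (-(p + q)) * (4 ^ (-κ) * c) * A ^ (p + q)
      ≤ V ^ 2 * V ^ (-(p + q)) * (R ^ κ * Ψ (4 * R)) * A ^ (p + q) := by gcongr
    _ = Ψ (4 * R) * ((R ^ N * V) ^ 2 *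
          (V ^ (-(p + q)) * R ^ ((2 * (m : ℝ) - N) * (p + q)) * A ^ (p + q))) := by
        rw [← hexp]
        ring
    _ ≤ _ := (mul_le_mul_of_nonneg_left hcs hΨ0).trans hker

lemma tendsto_atTop_of_frequently_add_le {F : ℝ → ℝ} (hF : Monotone F) (hF0 : ∀ R, 0 ≤ F R)
    {δ : ℝ} (hδ : 0 < δ)
    (h : ∃ᶠ R in atTop, ∀ R' < R / 2, F R' + δ ≤ F R) : Tendsto F atTop atTop := by
  have key : ∀ n : ℕ, ∃ R, n * δ ≤ F R := by
    intro n
    induction n with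
    | zero => exact ⟨0, by simpa using hF0 0⟩
    | succ n ih =>
      obtain ⟨R', hR'⟩ := ih
      obtain ⟨R, hR, hlt⟩ := (h.and_eventually (eventually_gt_atTop (2 * R'))).exists
      refine ⟨R, ?_⟩
      have := hR R' (by linarith)
      push_cast
      linarith
  refine tendsto_atTop_atTop_of_monotone hF fun b => ?_
  obtain ⟨n, hn⟩ := exists_nat_ge (b / δ)
  obtain ⟨R, hR⟩ := key n
  exact ⟨R, ((div_le_iff₀ hδ).1 hn).trans hR⟩

lemma false_of_frequently_mul_rpow_le {F G : ℝ → ℝ} (hF : Monotone F) (hG : Monotone G)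
    (hF0 : ∀ R, 0 ≤ F R) (hG0 : ∀ R, 0 ≤ G R) {σ τ c : ℝ} (hσ : 2 ≤ σ) (hτ : 2 ≤ τ) (hc : 0 < c)
    (h : ∃ᶠ R in atTop, (∀ R' < R / 2, F R' + c * G R ^ σ ≤ F R)
      ∧ ∀ R' < R / 2, G R' + c * F R ^ τ ≤ G R)
    {R₀ : ℝ} (hR₀ : 0 < G R₀) : False := by
  have hFt : Tendsto F atTop atTop := by
    refine tendsto_atTop_of_frequently_add_le hF hF0
      (δ := c * G R₀ ^ σ) (mul_pos hc (Real.rpow_pos_of_pos hR₀ σ)) ?_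
    refine (h.and_eventually (eventually_ge_atTop R₀)).mono fun R hR R' hR' => ?_
    refine le_trans ?_ (hR.1.1 R' hR')
    have := hG hR.2
    gcongr
  obtain ⟨R₁, hR₁⟩ := (hFt.eventually_gt_atTop 0).exists
  have hGt : Tendsto G atTop atTop := by
    refine tendsto_atTop_of_frequently_add_le hG hG0
      (δ := c * F R₁ ^ τ) (mul_pos hc (Real.rpow_pos_of_pos hR₁ τ)) ?_
    refine (h.and_eventually (eventually_ge_atTop R₁)).mono fun R hR R' hR' => ?_
    refine le_trans ?_ (hR.1.2 R' hR')
    have := hF hR.2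
    gcongr
  obtain ⟨R, ⟨hR1, hR2⟩, ⟨hFR, hGR⟩, hFc, hGc⟩ := (h.and_eventually
    (((hFt.eventually_ge_atTop 1).and (hGt.eventually_ge_atTop 1)).and
      ((hFt.eventually_gt_atTop (1 / c)).and (hGt.eventually_gt_atTop (1 / c))))).exists
  have h1 := hR1 (R / 2 - 1) (by linarith)
  have h2 := hR2 (R / 2 - 1) (by linarith)
  have h3 := hF0 (R / 2 - 1)
  have h4 := hG0 (R / 2 - 1)
  have h5 : G R ^ (2 : ℕ) ≤ G R ^ σ := by
    rw [← Real.rpow_natCast]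
    exact Real.rpow_le_rpow_of_exponent_le hGR (by exact_mod_cast hσ)
  have h6 : F R ^ (2 : ℕ) ≤ F R ^ τ := by
    rw [← Real.rpow_natCast]
    exact Real.rpow_le_rpow_of_exponent_le hFR (by exact_mod_cast hτ)
  rw [div_lt_iff₀ hc] at hFc hGc
  have h7 : c * G R ^ 2 ≤ F R := by
    have := mul_le_mul_of_nonneg_left h5 hc.le
    linarith
  have h8 : c * F R ^ 2 ≤ G R := by
    have := mul_le_mul_of_nonneg_left h6 hc.le
    linarith
  rcases le_total (F R) (G R) with h9 | h9 <;> nlinarith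

lemma setIntegral_closedBall_add_closedShell_le {N : ℕ} {f : EuclideanSpace ℝ (Fin N) → ℝ}
    (hf : Continuous f) (hf0 : ∀ x, 0 ≤ f x) {R R' : ℝ} (hR : R' < R / 2) (hR0 : 0 ≤ R) :
    (∫ x in closedBall 0 (2 * R'), f x) + ∫ x in closedShell N R, f x
      ≤ ∫ x in closedBall 0 (2 * R), f x := by
  have hi : ∀ r, IntegrableOn f (closedBall 0 r) := fun r =>
    hf.continuousOn.integrableOn_compact (isCompact_closedBall _ _)
  have his : IntegrableOn f (closedShell N R) :=
    hf.continuousOn.integrableOn_compact (isCompact_closedShell R)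
  rw [← setIntegral_union ?_ (measurableSet_closedShell R) (hi _) his]
  · refine setIntegral_mono_set (hi _) (ae_of_all _ hf0) (LE.le.eventuallyLE ?_)
    exact Set.union_subset (closedBall_subset_closedBall (by linarith))
      (closedShell_subset_closedBall R)
  · rw [Set.disjoint_left]
    intro x hx hx'
    have h1 : ‖x‖ ≤ 2 * R' := by simpa using hx
    have h2 : R ≤ ‖x‖ := hx'.1
    linarith

lemma exists_setIntegral_closedBall_pos {N : ℕ} (hN : 0 < N) {Ψ : ℝ → ℝ} (hK : CondK N Ψ)
    {p q : ℝ} (hp : 0 ≤ p) (hq : 0 ≤ q) {v f : EuclideanSpace ℝ (Fin N) → ℝ} (hv : Continuous v)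
    (hv0 : ∀ x, 0 ≤ v x)
    (hint : IntegrableOn (fun y : EuclideanSpace ℝ (Fin N) => v y ^ p * Ψ (‖y‖ / 2))
      {y | 1 < ‖y‖})
    (hf : Continuous f) (hfv : ∀ x, (∫ y, v y ^ p * Ψ ‖y - x‖) * v x ^ q ≤ f x)
    {x₀ : EuclideanSpace ℝ (Fin N)} (hx₀ : v x₀ ≠ 0) :
    ∃ R, 0 < ∫ x in closedBall 0 (2 * R), f x := by
  have hx := (hv0 x₀).lt_of_ne' hx₀
  set ρ := ‖x₀‖ + 1 with hρ
  have hρ0 : 0 < ρ := by positivity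
  have hpos : ∀ r : ℝ, 0 ≤ r → 0 < ∫ x in closedBall 0 ρ, v x ^ r := by
    intro r hr
    have hvr : Continuous fun x => v x ^ r := hv.rpow_const fun _ => Or.inr hr
    rw [setIntegral_pos_iff_support_of_nonneg_ae
      (ae_of_all _ fun x => Real.rpow_nonneg (hv0 x) r)
      (hvr.continuousOn.integrableOn_compact (isCompact_closedBall _ _))]
    have hop : IsOpen (ball 0 ρ ∩ {x | 0 < v x}) :=
      isOpen_ball.inter (isOpen_lt continuous_const hv)
    refine (hop.measure_pos volume ⟨x₀, by simp [hρ], hx⟩).trans_le (measure_mono ?_)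
    exact fun x hx => ⟨(Real.rpow_pos_of_pos hx.2 r).ne', ball_subset_closedBall hx.1⟩
  refine ⟨ρ / 2, ?_⟩
  rw [mul_div_cancel₀ ρ two_ne_zero]
  exact (mul_pos (hK.pos (2 * ρ) (by positivity)) (mul_pos (hpos p hp) (hpos q hq))).trans_le
    (kernel_mul_integral_mul_integral_le hN hK hp hq hv hv0 hint hf hfv
      (isCompact_closedBall _ _) subset_rfl)

end Liouville
theorem stmt_10 (N m : ℕ) (hm : 1 ≤ m) (hN : 2 * m < N)
    (n : ℕ) (hn : 2 ≤ n)
    (e : Fin n → Fin n → ℝ)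
    (he : ∀ i j, e i j = if i = j then 0 else 1)
    (p q : Fin n → Fin n → ℝ)
    (hp : ∀ i j, i ≠ j → 1 ≤ p i j) (hq : ∀ i j, i ≠ j → 0 < q i j)
    (hpq : ∀ i j, i ≠ j → 2 ≤ p i j + q i j)
    (Ψ : Fin n → Fin n → ℝ → ℝ) (hK : ∀ i j, CondK N (Ψ i j))
    (hlimsup : ∀ k l : Fin n, k ≠ l → ∃ c : ℝ, 0 < c ∧ ∃ᶠ r : ℝ in atTop,
      c ≤ min (r ^ (2 * (N : ℝ) - ((N : ℝ) - 2 * m) * (p k l + q k l)) * Ψ k l r)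
              (r ^ (2 * (N : ℝ) - ((N : ℝ) - 2 * m) * (p l k + q l k)) * Ψ l k r))
    (u : Fin n → EuclideanSpace ℝ (Fin N) → ℝ)
    (hreg : ∀ j, ContDiff ℝ (2 * m) (u j))
    (hpos : ∀ j x, 0 ≤ u j x)
    (hint : ∀ i j, IntegrableOn
      (fun y : EuclideanSpace ℝ (Fin N) => u j y ^ p i j * Ψ i j (‖y‖ / 2))
      {y : EuclideanSpace ℝ (Fin N) | 1 < ‖y‖})
    (hineq : ∀ i, ∀ x : EuclideanSpace ℝ (Fin N),
      (∑ j, e i j * ((∫ y : EuclideanSpace ℝ (Fin N), u j y ^ p i j * Ψ i j ‖y - x‖)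
        * u j x ^ q i j)) ≤ negLapPow m (u i) x) :
    ∀ i, ∀ x, u i x = 0 := by
  have hN0 : 0 < N := by omega
  have hreg' : ∀ j, ContDiff ℝ ((2 * m : ℕ) : WithTop ℕ∞) (u j) := fun j => by
    exact_mod_cast hreg j
  have huc : ∀ j, Continuous (u j) := fun j => (hreg j).continuous
  have hfc : ∀ j, Continuous (negLapPow m (u j)) := fun j =>
    (contDiff_negLapPow (k := m) (j := 0) (by simpa using hreg' j)).continuous
  have hterm : ∀ i j x, 0 ≤ e i j * ((∫ y : EuclideanSpace ℝ (Fin N),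
      u j y ^ p i j * Ψ i j ‖y - x‖) * u j x ^ q i j) := by
    intro i j x
    have h1 := integral_rpow_mul_kernel_nonneg (p := p i j) hN0 (hK i j) (hpos j) x
    have h2 := Real.rpow_nonneg (hpos j x) (q i j)
    rw [he]
    split_ifs <;> positivity
  have hf0 : ∀ i x, 0 ≤ negLapPow m (u i) x := fun i x =>
    (Finset.sum_nonneg fun j _ => hterm i j x).trans (hineq i x)
  have hfu : ∀ k l, k ≠ l → ∀ x, (∫ y : EuclideanSpace ℝ (Fin N),
      u l y ^ p k l * Ψ k l ‖y - x‖) * u l x ^ q k l ≤ negLapPow m (u k) x := by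
    intro k l hkl x
    have h := (Finset.single_le_sum (f := fun j => e k j * ((∫ y : EuclideanSpace ℝ (Fin N),
      u j y ^ p k j * Ψ k j ‖y - x‖) * u j x ^ q k j)) (fun j _ => hterm k j x)
      (Finset.mem_univ l)).trans (hineq k x)
    simpa [he, hkl] using h
  obtain ⟨K, hK0, hKF⟩ := exists_setIntegral_negLapPow_le (m := m) (d := N - 2 * m) (N := N) hm
    (by omega) (by omega)
  set F : Fin n → ℝ → ℝ := fun k R => ∫ x in closedBall 0 (2 * R), negLapPow m (u k) x with hF
  have hF0 : ∀ k R, 0 ≤ F k R := fun k R => integral_nonneg (hf0 k)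
  have hFmono : ∀ k, Monotone (F k) := fun k R R' h =>
    setIntegral_mono_set ((hfc k).continuousOn.integrableOn_compact (isCompact_closedBall _ _))
      (ae_of_all _ (hf0 k))
      (LE.le.eventuallyLE (closedBall_subset_closedBall (by linarith)))
  have hstep : ∀ k l, k ≠ l → ∀ c : ℝ, 0 < c → ∃ b : ℝ, 0 < b ∧ ∀ R : ℝ, 0 < R →
      c ≤ (4 * R) ^ (2 * (N : ℝ) - ((N : ℝ) - 2 * m) * (p k l + q k l)) * Ψ k l (4 * R) →
      ∀ R' < R / 2, F k R' + b * F l R ^ (p k l + q k l) ≤ F k R := by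
    intro k l hkl c hc
    have hp0 : 0 ≤ p k l := by linarith [hp k l hkl]
    obtain ⟨b, hb, hbM⟩ := exists_mul_rpow_le_setIntegral_closedShell (m := m) hN0 hp0
      (hq k l hkl).le (hpq k l hkl) hc
    refine ⟨b * K⁻¹ ^ (p k l + q k l), by positivity, fun R hR hcR R' hR' => ?_⟩
    have h1 := hbM _ (hK k l) _ _ (huc l) (hpos l) (hint k l) (hfc k) (hfu k l hkl) R hR hcR
    have h2 := hKF (u l) (hreg' l) (hpos l) (hf0 l)
      (tendsto_mean_closedShell hN0 (hK k l) (hp k l hkl) (huc l) (hpos l) (hint k l)) R hR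
    have h3 := setIntegral_closedBall_add_closedShell_le (hfc k) (hf0 k) hR' hR.le
    have h4 : K⁻¹ * F l R ≤ (R ^ (2 * m))⁻¹ * ∫ x in closedShell N R, u l x := by
      rwa [inv_mul_le_iff₀ hK0]
    have h5 : b * K⁻¹ ^ (p k l + q k l) * F l R ^ (p k l + q k l)
        ≤ b * ((R ^ (2 * m))⁻¹ * ∫ x in closedShell N R, u l x) ^ (p k l + q k l) := by
      rw [mul_assoc, ← Real.mul_rpow (inv_nonneg.2 hK0.le) (hF0 l R)]
      refine mul_le_mul_of_nonneg_left (Real.rpow_le_rpow ?_ h4 ?_) hb.le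
      · exact mul_nonneg (inv_nonneg.2 hK0.le) (hF0 l R)
      · linarith [hpq k l hkl]
    linarith
  intro i x₀
  by_contra hx₀
  have : Nontrivial (Fin n) := Fin.nontrivial_iff_two_le.2 hn
  obtain ⟨j, hji⟩ := exists_ne i
  obtain ⟨c, hc, hfreq⟩ := hlimsup i j hji.symm
  obtain ⟨b₁, hb₁, hs₁⟩ := hstep i j hji.symm c hc
  obtain ⟨b₂, hb₂, hs₂⟩ := hstep j i hji c hc
  obtain ⟨R₀, hR₀⟩ := exists_setIntegral_closedBall_pos hN0 (hK j i)
    (by linarith [hp j i hji]) (hq j i hji).le (huc i) (hpos i) (hint j i) (hfc j)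
    (hfu j i hji) hx₀
  refine false_of_frequently_mul_rpow_le (hFmono i) (hFmono j) (hF0 i) (hF0 j)
    (hpq i j hji.symm) (hpq j i hji) (lt_min hb₁ hb₂) ?_ hR₀
  have hdiv : Tendsto (fun r : ℝ => r / 4) atTop atTop := tendsto_id.atTop_div_const (by norm_num)
  refine hdiv.frequently ((hfreq.and_eventually (eventually_gt_atTop 0)).mono ?_)
  rintro r ⟨hr, hr0⟩
  have hr4 : 4 * (r / 4) = r := by ring
  have hσ₁ := Real.rpow_nonneg (hF0 j (r / 4)) (p i j + q i j)
  have hσ₂ := Real.rpow_nonneg (hF0 i (r / 4)) (p j i + q j i)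
  refine ⟨fun R' hR' => ?_, fun R' hR' => ?_⟩
  · have h := hs₁ (r / 4) (by positivity) (by rw [hr4]; exact hr.trans (min_le_left _ _)) R' hR'
    have := mul_le_mul_of_nonneg_right (min_le_left b₁ b₂) hσ₁
    linarith
  · have h := hs₂ (r / 4) (by positivity) (by rw [hr4]; exact hr.trans (min_le_right _ _)) R' hR'
    have := mul_le_mul_of_nonneg_right (min_le_right b₁ b₂) hσ₂
    linarith
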